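/- arXiv:2011.04593 — 2 statements merged into one kernel-verified Lean document; each statement's English description precedes it below -/
import Mathlib

section
/- Let (N,R) be an STP instance with N=(V,E,σ). For every vertex u∈V and every set I⊆R with |I|≥2, the sub-SMT cost satisfies the Dreyfus–Wagner recurrence: l*(u,I) = min over v∈V of ( d_N(u,v) + min over J with ∅⊊J⊊I of ( l*(v,J) + l*(v,I∖J) ) ). -/
open SimpleGraph

variable {V : Type*}

/-- The cost of a walk: the sum of the costs of its edges. -/
def walkCost {G : SimpleGraph V} (σ : Sym2 V → ℕ) {u v : V} (w : G.Walk u v) : ℕ :=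
  (w.edges.map σ).sum

/-- The shortest-path distance `d_N(u,v)` in the network `(G, σ)`. -/
noncomputable def netDist (G : SimpleGraph V) (σ : Sym2 V → ℕ) (u v : V) : ℕ :=
  sInf {c | ∃ w : G.Walk u v, walkCost σ w = c}

/-- Shortest-path distance as a function on unordered pairs. -/
noncomputable def sym2Dist (G : SimpleGraph V) (σ : Sym2 V → ℕ) (e : Sym2 V) : ℕ :=
  sInf {c | ∃ x y : V, e = s(x, y) ∧ ∃ w : G.Walk x y, walkCost σ w = c}

/-- The cost of a subgraph: the sum of the costs of its edges. -/
noncomputable def subCost [Fintype V] {G : SimpleGraph V} (σ : Sym2 V → ℕ)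
    (H : G.Subgraph) : ℕ :=
  ∑ e ∈ H.edgeSet.toFinite.toFinset, σ e

/-- A Steiner tree for terminals `R`: a subtree of `G` whose vertex set contains `R`. -/
def IsSteinerTree {G : SimpleGraph V} (R : Set V) (H : G.Subgraph) : Prop :=
  H.coe.IsTree ∧ R ⊆ H.verts

/-- The minimum cost of a Steiner tree for `(G, σ, R)`. -/
noncomputable def csmt [Fintype V] (G : SimpleGraph V) (σ : Sym2 V → ℕ) (R : Set V) : ℕ :=
  sInf {c | ∃ H : G.Subgraph, IsSteinerTree R H ∧ subCost σ H = c}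

/-- A Steiner minimal tree (SMT). -/
def IsSMT [Fintype V] (G : SimpleGraph V) (σ : Sym2 V → ℕ) (R : Set V)
    (H : G.Subgraph) : Prop :=
  IsSteinerTree R H ∧ subCost σ H = csmt G σ R

/-- The sub-SMT cost `l*(u, I) = csmt(N, I ∪ {u})`. -/
noncomputable def lstar [Fintype V] (G : SimpleGraph V) (σ : Sym2 V → ℕ)
    (u : V) (I : Set V) : ℕ :=
  csmt G σ (I ∪ {u})

/-- The cost of a minimum spanning tree of the complete network on `S`
with edge weights `w` (as a function on unordered pairs of `V`). -/
noncomputable def mstCost [Fintype V] (w : Sym2 V → ℕ) (S : Set V) : ℕ :=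
  sInf {c | ∃ T : SimpleGraph ↥S, T.IsTree ∧
    c = ∑ e ∈ T.edgeSet.toFinite.toFinset, w (e.map (Subtype.val : ↥S → V))}

-- Auxiliary fold computing the Steiner distance of a walk: the pair of
-- (the maximum cost among the already completed elementary segments,
-- the cost of the initial elementary segment), where the walk is split at
-- every visited terminal of `R`.
open Classical in
noncomputable def segMax {G : SimpleGraph V} (σ : Sym2 V → ℕ) (R : Set V) :
    {a b : V} → G.Walk a b → ℕ × ℕ
  | _, _, SimpleGraph.Walk.nil => (0, 0)
  | _, _, @SimpleGraph.Walk.cons _ _ a c _ _ w =>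
      let p := segMax σ R w
      if c ∈ R then (max p.1 p.2, σ s(a, c)) else (p.1, σ s(a, c) + p.2)

/-- The Steiner distance of a walk with respect to terminals `R`:
the maximum cost among its elementary subpaths (obtained by splitting the
walk at the intermediate terminals). -/
noncomputable def walkSD {G : SimpleGraph V} (σ : Sym2 V → ℕ) (R : Set V)
    {a b : V} (w : G.Walk a b) : ℕ :=
  max (segMax σ R w).1 (segMax σ R w).2

/-- The restricted bottleneck Steiner distance `s̄(u,v)`: the minimum Steiner
distance among all paths connecting `u` and `v` that avoid the edge `{u,v}`. -/
noncomputable def restrictedBottleneck (G : SimpleGraph V) (σ : Sym2 V → ℕ)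
    (R : Set V) (u v : V) : ℕ :=
  sInf {c | ∃ w : G.Walk u v, w.IsPath ∧ s(u, v) ∉ w.edges ∧ walkSD σ R w = c}

/-- The bottleneck Steiner distance as a function on unordered pairs. -/
noncomputable def sym2Bottleneck (G : SimpleGraph V) (σ : Sym2 V → ℕ) (R : Set V)
    (e : Sym2 V) : ℕ :=
  sInf {c | ∃ x y : V, e = s(x, y) ∧ ∃ w : G.Walk x y, w.IsPath ∧ walkSD σ R w = c}

theorem csmt_le_sum_of_reachable [Fintype V] {G : SimpleGraph V} (σ : Sym2 V → ℕ) {S : Set V}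
    {F : Finset (Sym2 V)} (hF : (F : Set (Sym2 V)) ⊆ G.edgeSet) {r : V}
    (h : ∀ x ∈ S, (fromEdgeSet (F : Set (Sym2 V))).Reachable r x) :
    csmt G σ S ≤ ∑ e ∈ F, σ e := by
  classical
  set K := fromEdgeSet (F : Set (Sym2 V)) with hK
  let C := K.connectedComponentMk r
  obtain ⟨T, hTle, hT⟩ := C.connected_toSimpleGraph.exists_isTree_le
  have hTK : ∀ {a b : C}, T.Adj a b → s((a : V), (b : V)) ∈ F := by
    intro a b hab
    have hadj : K.Adj a b := C.toSimpleGraph_hom.map_adj (hTle hab)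
    simpa using ((fromEdgeSet_adj _).1 hadj).1
  let H : G.Subgraph :=
    { verts := C.supp
      Adj := fun a b => ∃ (ha : a ∈ C.supp) (hb : b ∈ C.supp), T.Adj ⟨a, ha⟩ ⟨b, hb⟩
      adj_sub := fun ⟨_, _, hab⟩ => hF (hTK hab)
      edge_vert := fun ⟨ha, _, _⟩ => ha
      symm := ⟨fun _ _ ⟨ha, hb, hab⟩ => ⟨hb, ha, hab.symm⟩⟩ }
  have hcoe : H.coe = T := by
    ext a b
    exact ⟨fun ⟨_, _, hab⟩ => hab, fun hab => ⟨a.2, b.2, hab⟩⟩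
  have hH : IsSteinerTree S H := by
    refine ⟨hcoe ▸ hT, fun x hx => ?_⟩
    exact ConnectedComponent.sound (h x hx).symm
  have hle : csmt G σ S ≤ subCost σ H := Nat.sInf_le ⟨H, hH, rfl⟩
  refine hle.trans (Finset.sum_le_sum_of_subset fun e he => ?_)
  rw [Set.Finite.mem_toFinset] at he
  induction e with
  | _ a b =>
    obtain ⟨_, _, hab⟩ := he
    exact hTK hab

theorem exists_sum_eq_csmt [Fintype V] {G : SimpleGraph V} (σ : Sym2 V → ℕ)
    (hconn : G.Connected) (S : Set V) :
    ∃ F : Finset (Sym2 V), (F : Set (Sym2 V)) ⊆ G.edgeSet ∧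
      (∀ x ∈ S, ∀ y ∈ S, (fromEdgeSet (F : Set (Sym2 V))).Reachable x y) ∧
      ∑ e ∈ F, σ e = csmt G σ S := by
  classical
  have hne : {c | ∃ H : G.Subgraph, IsSteinerTree S H ∧ subCost σ H = c}.Nonempty := by
    obtain ⟨T, hTG, hT⟩ := hconn.exists_isTree_le
    refine ⟨_, toSubgraph T hTG, ⟨?_, fun _ _ => trivial⟩, rfl⟩
    let f : (toSubgraph T hTG).coe ≃g T :=
      { toEquiv := Equiv.Set.univ V
        map_rel_iff' := Iff.rfl }
    exact f.isTree_iff.2 hT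
  obtain ⟨H, ⟨hT, hS⟩, hc⟩ := Nat.sInf_mem hne
  refine ⟨H.edgeSet.toFinite.toFinset, ?_, fun x hx y hy => ?_, hc⟩
  · simpa using H.edgeSet_subset
  · let f : H.coe →g fromEdgeSet (H.edgeSet.toFinite.toFinset : Set (Sym2 V)) :=
      { toFun := Subtype.val
        map_rel' := fun {a b} hab => by
          have hab' : H.Adj a b := hab
          simpa using ⟨hab', hab'.ne⟩ }
    exact (hT.connected.preconnected ⟨x, hS hx⟩ ⟨y, hS hy⟩).map f

theorem SimpleGraph.Walk.reachable_fromEdgeSet_edges {G : SimpleGraph V} {u v : V}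
    (w : G.Walk u v) : (fromEdgeSet {e | e ∈ w.edges}).Reachable u v :=
  ⟨w.transfer _ fun e he => by
    simpa using ⟨he, G.not_isDiag_of_mem_edgeSet (w.edges_subset_edgeSet he)⟩⟩

theorem exists_walkCost_eq_netDist {G : SimpleGraph V} (σ : Sym2 V → ℕ) (hconn : G.Connected)
    (u v : V) : ∃ w : G.Walk u v, walkCost σ w = netDist G σ u v := by
  obtain ⟨w⟩ := hconn.preconnected u v
  exact Nat.sInf_mem (s := {c | ∃ w : G.Walk u v, walkCost σ w = c}) ⟨_, w, rfl⟩

theorem netDist_self {G : SimpleGraph V} (σ : Sym2 V → ℕ) (u : V) : netDist G σ u u = 0 :=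
  Nat.le_zero.1 (Nat.sInf_le ⟨Walk.nil, rfl⟩)

theorem netDist_le_add {G : SimpleGraph V} (σ : Sym2 V → ℕ) (hconn : G.Connected)
    {u w : V} (huw : G.Adj u w) (v : V) :
    netDist G σ u v ≤ σ s(u, w) + netDist G σ w v := by
  obtain ⟨p, hp⟩ := exists_walkCost_eq_netDist σ hconn w v
  rw [← hp]
  exact Nat.sInf_le ⟨Walk.cons huw p, by simp [walkCost]⟩

theorem List.sum_toFinset_le_sum_map {α : Type*} [DecidableEq α] (f : α → ℕ) (l : List α) :
    ∑ a ∈ l.toFinset, f a ≤ (l.map f).sum := by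
  induction l with
  | nil => simp
  | cons a l ih =>
    rw [List.toFinset_cons, List.map_cons, List.sum_cons]
    by_cases ha : a ∈ l.toFinset
    · rw [Finset.insert_eq_of_mem ha]; omega
    · rw [Finset.sum_insert ha]; omega

theorem Finset.sum_union_le_add {α : Type*} [DecidableEq α] (f : α → ℕ) (s t : Finset α) :
    ∑ a ∈ s ∪ t, f a ≤ ∑ a ∈ s, f a + ∑ a ∈ t, f a := by
  rw [← Finset.sum_union_inter]
  exact Nat.le_add_right _ _

theorem lstar_le_netDist_add [Fintype V] {G : SimpleGraph V} (σ : Sym2 V → ℕ)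
    (hconn : G.Connected) (u v : V) (I J : Set V) :
    lstar G σ u I ≤ netDist G σ u v + (lstar G σ v J + lstar G σ v (I \ J)) := by
  classical
  obtain ⟨w, hw⟩ := exists_walkCost_eq_netDist σ hconn u v
  obtain ⟨A, hAG, hA, hAc⟩ := exists_sum_eq_csmt σ hconn (J ∪ {v})
  obtain ⟨B, hBG, hB, hBc⟩ := exists_sum_eq_csmt σ hconn (I \ J ∪ {v})
  have hcost : ∑ e ∈ w.edges.toFinset ∪ (A ∪ B), σ e ≤
      netDist G σ u v + (lstar G σ v J + lstar G σ v (I \ J)) := by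
    refine (Finset.sum_union_le_add σ _ _).trans (Nat.add_le_add ?_ ?_)
    · exact (List.sum_toFinset_le_sum_map σ _).trans hw.le
    · exact (Finset.sum_union_le_add σ _ _).trans (Nat.add_le_add hAc.le hBc.le)
  refine le_trans (csmt_le_sum_of_reachable σ (r := v) ?_ ?_) hcost
  · intro e he
    simp only [Finset.coe_union, Set.mem_union, Finset.mem_coe, List.mem_toFinset] at he
    rcases he with he | he | he
    · exact w.edges_subset_edgeSet he
    · exact hAG he
    · exact hBG he
  · rintro x (hx | rfl)
    · by_cases hxJ : x ∈ J
      · refine (hA v (by simp) x (by simp [hxJ])).mono (fromEdgeSet_mono ?_)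
        intro e he; simp_all
      · refine (hB v (by simp) x (by simp [hx, hxJ])).mono (fromEdgeSet_mono ?_)
        intro e he; simp_all
    · refine w.reachable_fromEdgeSet_edges.symm.mono (fromEdgeSet_mono ?_)
      intro e he; simp_all

theorem reachable_fromEdgeSet_filter {F : Set (Sym2 V)} {r x : V}
    (h : (fromEdgeSet F).Reachable r x) :
    (fromEdgeSet {e ∈ F | ∃ y ∈ e, (fromEdgeSet F).Reachable r y}).Reachable r x := by
  have h' := h
  rw [reachable_iff_reflTransGen] at h'
  induction h' with
  | refl => exact Reachable.refl _
  | @tail b c hb hbc ih =>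
    have hrb : (fromEdgeSet F).Reachable r b := (reachable_iff_reflTransGen _ _).2 hb
    refine (ih hrb).trans (Adj.reachable ?_)
    rw [fromEdgeSet_adj] at hbc ⊢
    exact ⟨⟨hbc.1, b, Sym2.mem_mk_left b c, hrb⟩, hbc.2⟩

theorem reachable_diff_singleton {F : Set (Sym2 V)} {u w x : V}
    (h : (fromEdgeSet F).Reachable u x) :
    (fromEdgeSet (F \ {s(u, w)})).Reachable u x ∨
      (fromEdgeSet (F \ {s(u, w)})).Reachable w x := by
  rw [reachable_iff_reflTransGen] at h
  induction h with
  | refl => exact Or.inl (Reachable.refl _)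
  | @tail b c _ hbc ih =>
    rw [fromEdgeSet_adj] at hbc
    by_cases he : s(b, c) = s(u, w)
    · rcases Sym2.eq_iff.1 he with ⟨_, rfl⟩ | ⟨_, rfl⟩
      · exact Or.inr (Reachable.refl _)
      · exact Or.inl (Reachable.refl _)
    · have hadj : (fromEdgeSet (F \ {s(u, w)})).Adj b c :=
        (fromEdgeSet_adj _).2 ⟨⟨hbc.1, he⟩, hbc.2⟩
      exact ih.imp (fun h => h.trans hadj.reachable) (fun h => h.trans hadj.reachable)

theorem csmt_add_csmt_le_sum [Fintype V] [DecidableEq V] {G : SimpleGraph V} (σ : Sym2 V → ℕ)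
    {F : Finset (Sym2 V)} (hF : (F : Set (Sym2 V)) ⊆ G.edgeSet) {u w : V} (he : s(u, w) ∈ F)
    (huw : ¬ (fromEdgeSet ((F.erase s(u, w) : Finset (Sym2 V)) : Set (Sym2 V))).Reachable u w)
    {S T : Set V}
    (hS : ∀ x ∈ S, (fromEdgeSet ((F.erase s(u, w) : Finset _) : Set (Sym2 V))).Reachable u x)
    (hT : ∀ x ∈ T, (fromEdgeSet ((F.erase s(u, w) : Finset _) : Set (Sym2 V))).Reachable w x) :
    lstar G σ u S + lstar G σ u T ≤ ∑ e ∈ F, σ e := by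
  classical
  set E := F.erase s(u, w) with hE
  set K := fromEdgeSet (E : Set (Sym2 V)) with hK
  have hEF : E ⊆ F := Finset.erase_subset _ _
  let A := {e ∈ E | ∃ y ∈ e, K.Reachable u y}
  let B := {e ∈ E | ∃ y ∈ e, K.Reachable w y}
  have hAr {x : V} (h : K.Reachable u x) : (fromEdgeSet (A : Set (Sym2 V))).Reachable u x := by
    simpa [A] using reachable_fromEdgeSet_filter h
  have hBr {x : V} (h : K.Reachable w x) : (fromEdgeSet (B : Set (Sym2 V))).Reachable w x := by
    simpa [B] using reachable_fromEdgeSet_filter h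
  have hAF : A ⊆ E := Finset.filter_subset _ _
  have hBF : B ⊆ E := Finset.filter_subset _ _
  have hdisj : Disjoint A B := by
    rw [Finset.disjoint_left]
    intro e heA heB
    obtain ⟨heE, y, hy, huy⟩ := Finset.mem_filter.1 heA
    obtain ⟨-, z, hz, hwz⟩ := Finset.mem_filter.1 heB
    refine huw ((huy.trans ?_).trans hwz.symm)
    by_cases hyz : y = z
    · exact hyz ▸ Reachable.refl _
    · refine Adj.reachable ((fromEdgeSet_adj _).2 ⟨?_, hyz⟩)
      rwa [← (Sym2.mem_and_mem_iff hyz).1 ⟨hy, hz⟩]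
  have heB : s(u, w) ∉ B := fun h => Finset.notMem_erase _ _ (hBF h)
  have hne : u ≠ w := fun h => huw (h ▸ Reachable.refl _)
  have hA : lstar G σ u S ≤ ∑ e ∈ A, σ e := by
    refine csmt_le_sum_of_reachable σ (r := u) (fun e h => hF (hEF (hAF h))) ?_
    rintro x (hx | rfl)
    · exact hAr (hS x hx)
    · exact Reachable.refl _
  have hB : lstar G σ u T ≤ ∑ e ∈ insert s(u, w) B, σ e := by
    refine csmt_le_sum_of_reachable σ (r := w) (fun e h => ?_) ?_
    · rcases Finset.mem_insert.1 h with rfl | h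
      · exact hF he
      · exact hF (hEF (hBF h))
    · rintro x (hx | rfl)
      · exact (hBr (hT x hx)).mono (fromEdgeSet_mono (by simp))
      · exact (Adj.reachable ((fromEdgeSet_adj _).2 ⟨by simp, hne⟩)).symm
  have hEsum := Finset.add_sum_erase F σ he
  have hAB : ∑ e ∈ A, σ e + ∑ e ∈ B, σ e ≤ ∑ e ∈ E, σ e := by
    rw [← Finset.sum_union hdisj]
    exact Finset.sum_le_sum_of_subset (Finset.union_subset hAF hBF)
  rw [Finset.sum_insert heB] at hB
  rw [← hE] at hEsum
  omega

theorem exists_netDist_add_le_sum [Fintype V] {G : SimpleGraph V} (σ : Sym2 V → ℕ)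
    (hconn : G.Connected) {I : Set V} (hI : 2 ≤ I.ncard) (F : Finset (Sym2 V))
    (hF : (F : Set (Sym2 V)) ⊆ G.edgeSet) (u : V)
    (hu : ∀ x ∈ I, (fromEdgeSet (F : Set (Sym2 V))).Reachable u x) :
    ∃ v : V, ∃ J : Set V, ∅ ⊂ J ∧ J ⊂ I ∧
      netDist G σ u v + (lstar G σ v J + lstar G σ v (I \ J)) ≤ ∑ e ∈ F, σ e := by
  classical
  induction F using Finset.strongInduction generalizing u with
  | H F ih =>
    obtain ⟨x, hxI, hxu⟩ := Set.exists_ne_of_one_lt_ncard hI u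
    obtain ⟨w, huw⟩ : ∃ w, (fromEdgeSet (F : Set (Sym2 V))).Adj u w := by
      obtain ⟨p⟩ := hu x hxI
      cases p with
      | nil => exact absurd rfl hxu
      | cons h _ => exact ⟨_, h⟩
    have he : s(u, w) ∈ F := by simpa using ((fromEdgeSet_adj _).1 huw).1
    have hGuw : G.Adj u w := hF he
    have hEF : F.erase s(u, w) ⊂ F := Finset.erase_ssubset he
    have hEG : ((F.erase s(u, w) : Finset _) : Set (Sym2 V)) ⊆ G.edgeSet :=
      fun e h => hF (hEF.1 h)
    have hsum := Finset.add_sum_erase F σ he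
    set K := fromEdgeSet ((F.erase s(u, w) : Finset _) : Set (Sym2 V)) with hK
    have hor : ∀ y ∈ I, K.Reachable u y ∨ K.Reachable w y := by
      intro y hy
      simpa [hK] using reachable_diff_singleton (w := w) (hu y hy)
    by_cases hall : ∀ y ∈ I, K.Reachable u y
    · obtain ⟨v, J, hJ, hJI, hle⟩ := ih _ hEF hEG u hall
      exact ⟨v, J, hJ, hJI, by omega⟩
    by_cases hnone : ∀ y ∈ I, K.Reachable w y
    · obtain ⟨v, J, hJ, hJI, hle⟩ := ih _ hEF hEG w hnone
      have := netDist_le_add σ hconn hGuw v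
      exact ⟨v, J, hJ, hJI, by omega⟩
    push Not at hall hnone
    obtain ⟨y, hyI, hy⟩ := hall
    obtain ⟨z, hzI, hz⟩ := hnone
    have hKuw : ¬ K.Reachable u w := fun h => (hor y hyI).elim hy fun h' => hy (h.trans h')
    refine ⟨u, {x ∈ I | K.Reachable u x}, ?_, ?_, ?_⟩
    · exact Set.empty_ssubset.2 ⟨z, hzI, (hor z hzI).resolve_right hz⟩
    · exact (Set.ssubset_iff_of_subset (Set.sep_subset _ _)).2 ⟨y, hyI, fun h => hy h.2⟩
    · rw [netDist_self, zero_add]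
      refine csmt_add_csmt_le_sum σ hF he hKuw (fun x hx => hx.2) fun x hx => ?_
      exact (hor x hx.1).resolve_left fun h => hx.2 ⟨hx.1, h⟩

/-- The Dreyfus–Wagner recurrence for sub-SMT costs. -/
theorem dreyfus_wagner_recurrence
    [Fintype V] (G : SimpleGraph V) (σ : Sym2 V → ℕ)
    (hconn : G.Connected) (hpos : ∀ e ∈ G.edgeSet, 0 < σ e)
    (R : Set V) (hR : R.Nonempty)
    (u : V) (I : Set V) (hIR : I ⊆ R) (hI : 2 ≤ I.ncard) :
    lstar G σ u I =
      sInf {c | ∃ v : V, ∃ J : Set V, ∅ ⊂ J ∧ J ⊂ I ∧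
        c = netDist G σ u v + (lstar G σ v J + lstar G σ v (I \ J))} := by
  refine le_antisymm (le_csInf ?_ ?_) ?_
  · obtain ⟨x, hx, -⟩ := Set.exists_ne_of_one_lt_ncard hI u
    obtain ⟨y, hy, hyx⟩ := Set.exists_ne_of_one_lt_ncard hI x
    refine ⟨_, u, {x}, Set.empty_ssubset.2 ⟨x, rfl⟩, ?_, rfl⟩
    exact (Set.ssubset_iff_of_subset (Set.singleton_subset_iff.2 hx)).2 ⟨y, hy, hyx⟩
  · rintro c ⟨v, J, -, -, rfl⟩
    exact lstar_le_netDist_add σ hconn u v I J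
  · obtain ⟨F, hFG, hF, hFc⟩ := exists_sum_eq_csmt σ hconn (I ∪ {u})
    obtain ⟨v, J, hJ, hJI, hle⟩ := exists_netDist_add_le_sum σ hconn hI F hFG u
      fun x hx => hF u (Or.inr rfl) x (Or.inl hx)
    refine le_trans (Nat.sInf_le ?_) (hle.trans hFc.le)
    exact ⟨v, J, hJ, hJI, rfl⟩
end

section
/- Let (N,R) be an STP instance with N=(V,E,σ) and |R|≥2. Let z∈R and let e={z,z'} be an edge of minimum cost among all edges incident to z. If the other endpoint z' is also a terminal (z'∈R), then at least one SMT of (N,R) contains the edge e. -/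
open SimpleGraph

variable {V : Type*}

namespace SimpleGraph.Subgraph

variable {G : SimpleGraph V}

/-- Remove the edge `s(a, b)` from a subgraph and insert the edge `s(u, v)` between two of its
vertices. -/
def exchange (T : G.Subgraph) (a b : V) {u v : V} (huv : G.Adj u v)
    (hu : u ∈ T.verts) (hv : v ∈ T.verts) : G.Subgraph where
  verts := T.verts
  Adj x y := T.Adj x y ∧ s(x, y) ≠ s(a, b) ∨ s(x, y) = s(u, v)
  adj_sub := by
    rintro x y (⟨h, -⟩ | h)
    · exact h.adj_sub
    · rwa [← mem_edgeSet, h]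
  edge_vert := by
    rintro x y (⟨h, -⟩ | h)
    · exact h.fst_mem
    · rcases Sym2.eq_iff.1 h with ⟨rfl, -⟩ | ⟨rfl, -⟩ <;> assumption
  symm := ⟨fun x y h => by rwa [T.adj_comm, Sym2.eq_swap (a := y)]⟩

lemma edgeSet_exchange (T : G.Subgraph) (a b : V) {u v : V} (huv : G.Adj u v)
    (hu : u ∈ T.verts) (hv : v ∈ T.verts) :
    (T.exchange a b huv hu hv).edgeSet = insert s(u, v) (T.edgeSet \ {s(a, b)}) := by
  ext e
  induction e using Sym2.ind with | h x y =>
  change T.Adj x y ∧ s(x, y) ≠ s(a, b) ∨ s(x, y) = s(u, v) ↔ _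
  simp only [Set.mem_insert_iff, Set.mem_sdiff, Set.mem_singleton_iff]
  tauto

lemma natCard_edgeSet_coe (T : G.Subgraph) : Nat.card T.coe.edgeSet = T.edgeSet.ncard := by
  rw [← T.image_coe_edgeSet_coe,
    Set.ncard_image_of_injective _ (Sym2.map.injective Subtype.val_injective), Set.ncard_def,
    Set.encard, Nat.card]
  rfl

/-- If `w` and `v` are joined by a walk in `T` avoiding `u`, then exchanging `s(u, w)` for
`s(u, v)` preserves connectedness. -/
lemma connected_exchange {T : G.Subgraph} (hT : T.coe.Connected) {u w v : T.verts}
    (p : T.coe.Walk w v) (hp : u ∉ p.support) (huv : G.Adj u v) :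
    (T.exchange u w huv u.2 v.2).coe.Connected := by
  set T' := T.exchange u w huv u.2 v.2 with hT'
  have hwv : ∀ {x y : T.verts} (q : T.coe.Walk x y), u ∉ q.support →
      T'.coe.Reachable x y := by
    intro x y q
    induction q with
    | nil => exact fun _ => .refl _
    | @cons x c y h q ih =>
      intro hq
      rw [Walk.support_cons, List.mem_cons, not_or] at hq
      refine .trans (Adj.reachable (Or.inl ⟨h, fun he => ?_⟩)) (ih hq.2)
      rcases Sym2.eq_iff.1 he with ⟨h1, -⟩ | ⟨-, h1⟩
      · exact hq.1 (Subtype.ext h1.symm)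
      · exact hq.2 (Subtype.ext h1 ▸ q.start_mem_support)
  have huv' : T'.coe.Reachable u v := Adj.reachable (Or.inr rfl)
  have huw' : T'.coe.Reachable u w := huv'.trans (hwv p hp).symm
  have hadj : ∀ x y : T.verts, T.coe.Adj x y → T'.coe.Reachable x y := by
    intro x y h
    by_cases he : s((x : V), (y : V)) = s((u : V), (w : V))
    · rcases Sym2.eq_iff.1 he with ⟨h1, h2⟩ | ⟨h1, h2⟩
      · rwa [Subtype.ext h1, Subtype.ext h2]
      · rw [Subtype.ext h1, Subtype.ext h2]
        exact huw'.symm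
    · exact Adj.reachable (Or.inl ⟨h, he⟩)
  have hwalk : ∀ {x y : T.verts}, T.coe.Walk x y → T'.coe.Reachable x y := by
    intro x y q
    induction q with
    | nil => exact .refl _
    | cons h q ih => exact (hadj _ _ h).trans ih
  exact (connected_iff _).2 ⟨fun x y => (hT.preconnected x y).elim hwalk, ⟨u⟩⟩

/-- Exchanging the first edge of a path in a tree for the edge joining its endpoints yields a
tree. -/
lemma isTree_exchange [Finite V] {T : G.Subgraph} (hT : T.coe.IsTree) {u w v : T.verts}
    (huw : T.coe.Adj u w) (p : T.coe.Walk w v) (hp : u ∉ p.support) (huv : G.Adj u v)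
    (hnadj : ¬ T.Adj u v) : (T.exchange u w huv u.2 v.2).coe.IsTree := by
  rw [isTree_iff_connected_and_card] at hT ⊢
  refine ⟨connected_exchange hT.1 p hp huv, ?_⟩
  have hcard := hT.2
  rw [natCard_edgeSet_coe] at hcard ⊢
  rw [edgeSet_exchange, Set.ncard_insert_of_notMem (fun h => hnadj h.1),
    Set.ncard_sdiff_singleton_add_one (show s((u : V), (w : V)) ∈ T.edgeSet from huw)]
  exact hcard

end SimpleGraph.Subgraph

lemma subCost_exchange_le [Fintype V] {G : SimpleGraph V} (σ : Sym2 V → ℕ) (T : G.Subgraph)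
    {a b u v : V} (hab : T.Adj a b) (huv : G.Adj u v) (hu : u ∈ T.verts) (hv : v ∈ T.verts)
    (hle : σ s(u, v) ≤ σ s(a, b)) :
    subCost σ (T.exchange a b huv hu hv) ≤ subCost σ T := by
  classical
  have hset : (T.exchange a b huv hu hv).edgeSet.toFinite.toFinset =
      insert s(u, v) (T.edgeSet.toFinite.toFinset.erase s(a, b)) := by
    ext e
    simp [Subgraph.edgeSet_exchange, and_comm]
  have hmem : s(a, b) ∈ T.edgeSet.toFinite.toFinset := by simpa using hab
  unfold subCost
  rw [hset, ← Finset.add_sum_erase _ _ hmem]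
  by_cases h : s(u, v) ∈ T.edgeSet.toFinite.toFinset.erase s(a, b)
  · rw [Finset.insert_eq_of_mem h]
    exact Nat.le_add_left _ _
  · rw [Finset.sum_insert h]
    gcongr

lemma exists_isSMT [Fintype V] {G : SimpleGraph V} (hG : G.Connected) (σ : Sym2 V → ℕ)
    (R : Set V) : ∃ T : G.Subgraph, IsSMT G σ R T := by
  obtain ⟨T, hle, hT⟩ := hG.exists_isTree_le
  have hS : IsSteinerTree R (toSubgraph T hle) :=
    ⟨(Subgraph.spanningCoeEquivCoeOfSpanning _ (toSubgraph.isSpanning T hle)).isTree_iff.1 hT,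
      Set.subset_univ R⟩
  exact Nat.sInf_mem (s := {c | ∃ H : G.Subgraph, IsSteinerTree R H ∧ subCost σ H = c})
    ⟨_, _, hS, rfl⟩

lemma csmt_le_subCost [Fintype V] {G : SimpleGraph V} (σ : Sym2 V → ℕ) {R : Set V}
    {H : G.Subgraph} (hH : IsSteinerTree R H) : csmt G σ R ≤ subCost σ H :=
  Nat.sInf_le ⟨H, hH, rfl⟩

/-- If the minimum-cost edge incident to a terminal `z` leads to
another terminal `z'`, then some SMT contains this edge. -/
theorem min_terminal_edge_in_some_smt
    [Fintype V] (G : SimpleGraph V) (σ : Sym2 V → ℕ)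
    (hconn : G.Connected) (hpos : ∀ e ∈ G.edgeSet, 0 < σ e)
    (R : Set V) (hR : 2 ≤ R.ncard)
    (z z' : V) (hz : z ∈ R) (hz' : z' ∈ R) (hadj : G.Adj z z')
    (hmin : ∀ y : V, G.Adj z y → σ s(z, z') ≤ σ s(z, y)) :
    ∃ H : G.Subgraph, IsSMT G σ R H ∧ s(z, z') ∈ H.edgeSet := by
  obtain ⟨T, ⟨hT, hRT⟩, hcost⟩ := exists_isSMT hconn σ R
  by_cases hzz' : T.Adj z z'
  · exact ⟨T, ⟨⟨hT, hRT⟩, hcost⟩, hzz'⟩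
  obtain ⟨p, hp⟩ := (hT.connected ⟨z, hRT hz⟩ ⟨z', hRT hz'⟩).exists_isPath
  cases p with
  | nil => exact absurd hadj (G.irrefl)
  | @cons _ w _ h p =>
    have hS : IsSteinerTree R (T.exchange z w hadj (hRT hz) (hRT hz')) :=
      ⟨Subgraph.isTree_exchange hT h p ((Walk.cons_isPath_iff h p).1 hp).2 hadj hzz', hRT⟩
    refine ⟨_, ⟨hS, le_antisymm ?_ (csmt_le_subCost σ hS)⟩, Or.inr rfl⟩
    exact (subCost_exchange_le σ T h hadj (hRT hz) (hRT hz') (hmin w (T.adj_sub h))).trans_eq hcost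
end
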